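/- Let W be a vector space over ℂ and let (a(x), b(x)) be a quasi compatible ordered pair in ℰ(W). Then for any α, β ∈ ℂˣ the ordered pairs (a′(x), b(x)), (a(x), b′(x)) and (a(αx), b(βx)) are quasi compatible, and the following identities hold: Y_ℰ^{(α)}(Da(x), x₀)b(x) = (∂/∂x₀) Y_ℰ^{(α)}(a(x), x₀)b(x); D Y_ℰ^{(α)}(a(x), x₀)b(x) − Y_ℰ^{(α)}(a(x), x₀) D b(x) = α (∂/∂x₀) Y_ℰ^{(α)}(a(x), x₀)b(x); R_α Y_ℰ^{(β)}(a(x), x₀)b(x) = Y_ℰ^{(αβ)}(a(x), x₀) R_α b(x); and Y_ℰ^{(α)}(R_β a(x), β⁻¹x₀)b(x) = Y_ℰ^{(αβ)}(a(x), x₀)b(x). In particular, Y_ℰ^{(α)}(a(x), x₀)b(x) = R_α Y_ℰ(a(x), x₀) R_{α⁻¹} b(x) = Y_ℰ(R_α a(x), α⁻¹x₀) b(x). -/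

import Mathlib

noncomputable section

open Classical

namespace NVA

/-! ### The space ℰ(W) = Hom(W, W((x))), coefficient-indexed by modes:
`a w n` is the mode `a_n` applied to `w`, where `a(x)w = ∑ (a_n w) x^{-n-1}`.
Lower truncation of `a(x)w` in powers of `x` means `a_n w = 0` for `n` large. -/

variable (W : Type*) [AddCommGroup W] [Module ℂ W]

/-- `ℰ(W) = Hom(W, W((x)))` as a submodule of `Hom(W, W[[x^{±1}]])`. -/
def EWsub : Submodule ℂ (W →ₗ[ℂ] (ℤ → W)) where
  carrier := {a | ∀ w : W, ∃ N : ℤ, ∀ n : ℤ, N ≤ n → a w n = 0}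
  add_mem' := by
    intro a b ha hb w
    obtain ⟨N, hN⟩ := ha w
    obtain ⟨M, hM⟩ := hb w
    refine ⟨max N M, fun n hn => ?_⟩
    simp only [LinearMap.add_apply, Pi.add_apply,
      hN n (le_trans (le_max_left _ _) hn), hM n (le_trans (le_max_right _ _) hn), add_zero]
  zero_mem' := by intro w; exact ⟨0, fun n _ => rfl⟩
  smul_mem' := by
    intro c a ha w
    obtain ⟨N, hN⟩ := ha w
    exact ⟨N, fun n hn => by
      simp only [LinearMap.smul_apply, Pi.smul_apply, hN n hn, smul_zero]⟩

/-- The type `ℰ(W)`. -/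
abbrev EW := ↥(EWsub W)

variable {W}

/-- The mode function of an element of `ℰ(W)`. -/
def mf (a : EW W) : W → ℤ → W := fun w n => (a : W →ₗ[ℂ] (ℤ → W)) w n

/-- The identity operator `1_W`, as an element of `ℰ(W)`. -/
def oneE : EW W :=
  ⟨{ toFun := fun w n => if n = -1 then w else 0
     map_add' := by
       intro w w'; funext n; by_cases h : n = -1 <;> simp [h]
     map_smul' := by
       intro c w; funext n; by_cases h : n = -1 <;> simp [h] },
   fun w => ⟨0, fun n hn => if_neg (by omega)⟩⟩

/-- The generalized binomial coefficient `C(m, j)` for `m ∈ ℤ`, as a complex number. -/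
def binom (m : ℤ) (j : ℕ) : ℂ :=
  (∏ i ∈ Finset.range j, ((m : ℂ) - (i : ℂ))) / (j.factorial : ℂ)

/-- The coefficient of `x₁^m x₂^t` in `a(x₁) b(x₂) w`. -/
def Fab (a b : EW W) (w : W) (m t : ℤ) : W := mf a (mf b w (-t - 1)) (-m - 1)

/-- Multiplication of a two-variable family by a polynomial `p(x₁,x₂)`. -/
def mulPoly (p : MvPolynomial (Fin 2) ℂ) (F : ℤ → ℤ → W) : ℤ → ℤ → W :=
  fun m t => ∑ d ∈ p.support, MvPolynomial.coeff d p • F (m - d 0) (t - d 1)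

/-- A two-variable family lies in `W((x₁,x₂))` (jointly lower truncated). -/
def IsLaurent2 (F : ℤ → ℤ → W) : Prop :=
  ∃ N : ℤ, ∀ m t : ℤ, (m < N ∨ t < N) → F m t = 0

/-- Quasi compatibility of an ordered pair `(a(x), b(x))` in `ℰ(W)`:
`p(x₁,x₂) a(x₁) b(x₂) ∈ Hom(W, W((x₁,x₂)))` for some nonzero polynomial `p`. -/
def QCPair (a b : EW W) : Prop :=
  ∃ p : MvPolynomial (Fin 2) ℂ, p ≠ 0 ∧ ∀ w, IsLaurent2 (mulPoly p (Fab a b w))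

/-! ### Sequences -/

/-- The coefficient of `x₁^{k 1} ⋯ x_r^{k r}` in `ψ₁(x₁) ⋯ ψ_r(x_r) w`. -/
def seqCoeff : {r : ℕ} → (Fin r → EW W) → W → (Fin r → ℤ) → W
  | 0, _, w, _ => w
  | _ + 1, ψ, w, k => mf (ψ 0) (seqCoeff (Fin.tail ψ) w (Fin.tail k)) (-(k 0) - 1)

/-- The polynomial `∏_{1 ≤ i < j ≤ r} p(x_i, x_j)`. -/
def pairPoly (p : MvPolynomial (Fin 2) ℂ) (r : ℕ) : MvPolynomial (Fin r) ℂ :=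
  ∏ ij ∈ Finset.univ.filter (fun ij : Fin r × Fin r => ij.1 < ij.2),
    MvPolynomial.rename ![ij.1, ij.2] p

/-- Multiplication of an `r`-variable family by a polynomial in `r` variables. -/
def mulPolyN {r : ℕ} (P : MvPolynomial (Fin r) ℂ) (F : (Fin r → ℤ) → W) :
    (Fin r → ℤ) → W :=
  fun k => ∑ d ∈ P.support, MvPolynomial.coeff d P • F (fun i => k i - d i)

/-- An `r`-variable family lies in `W((x₁,…,x_r))`. -/
def IsLaurentN {r : ℕ} (F : (Fin r → ℤ) → W) : Prop :=
  ∃ N : ℤ, ∀ k : Fin r → ℤ, (∃ i, k i < N) → F k = 0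

/-- Quasi compatibility of an ordered sequence in `ℰ(W)`. -/
def QCSeq {r : ℕ} (ψ : Fin r → EW W) : Prop :=
  ∃ p : MvPolynomial (Fin 2) ℂ, p ≠ 0 ∧
    ∀ w, IsLaurentN (mulPolyN (pairPoly p r) (seqCoeff ψ w))

/-- Quasi compatibility of a subset of `ℰ(W)`. -/
def QCSet (S : Set (EW W)) : Prop :=
  ∀ (r : ℕ) (ψ : Fin r → EW W), (∀ i, ψ i ∈ S) → QCSeq ψ

/-! ### The vertex operation `Y_ℰ^{(α)}` -/

/-- `ℂ((x))`. -/
abbrev LC : Type := LaurentSeries ℂ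

/-- An iterated Laurent series field, e.g. `ℂ((x))((x₀))` (outer variable the second one). -/
abbrev K2 : Type := HahnSeries ℤ LC

/-- The outer variable of `K2`. -/
def xOuter : K2 := HahnSeries.single 1 1

/-- The inner variable of `K2`. -/
def xInner : K2 := HahnSeries.single 0 (HahnSeries.single 1 1)

/-- `α` times the inner variable of `K2`. -/
def xInnerC (c : ℂ) : K2 := HahnSeries.single 0 (HahnSeries.single 1 c)

/-- The polynomial `p(x₀ + α x, x)` as an element of `ℂ((x))((x₀))`
(outer variable `x₀`). -/
def qK (p : MvPolynomial (Fin 2) ℂ) (α : ℂ) : K2 :=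
  MvPolynomial.aeval ![xOuter + xInnerC α, xInner] p

/-- The expansion `ι_{x,x₀} (p(x₀ + α x, x)^{-1}) ∈ ℂ((x))((x₀))`. -/
def qInv (p : MvPolynomial (Fin 2) ℂ) (α : ℂ) : K2 := (qK p α)⁻¹

/-- The coefficient of `x₀^j x^t` in `(p(x₁,x) a(x₁) b(x) w)|_{x₁ = αx + x₀}`,
expanding via `(αx+x₀)^m = ∑_{j≥0} C(m,j) α^{m-j} x^{m-j} x₀^j`. -/
def substYE (α : ℂ) (p : MvPolynomial (Fin 2) ℂ) (a b : EW W) (w : W)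
    (j : ℕ) (t : ℤ) : W :=
  ∑ᶠ m : ℤ, (binom m j * α ^ (m - (j : ℤ))) • mulPoly p (Fab a b w) m (t - m + j)

/-- The coefficient of `x₀^J x^T` in
`ι_{x,x₀}(p(x₀+αx,x)^{-1}) ⬝ (p(x₁,x)a(x₁)b(x)w)|_{x₁ = αx+x₀}`. -/
def fullYE (α : ℂ) (p : MvPolynomial (Fin 2) ℂ) (a b : EW W) (w : W)
    (J T : ℤ) : W :=
  ∑ᶠ s : ℤ × ℤ, (((qInv p α).coeff s.1).coeff s.2) •
    (if 0 ≤ J - s.1 then substYE α p a b w (J - s.1).toNat (T - s.2) else 0)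

/-- The raw mode family of `Y_ℰ^{(α)}(a(x), x₀) b(x)`; `rawYE α a b n w m` is the mode
`m` of the element `a(x)_{(α,n)} b(x)` applied to `w`.  (Defined using a choice of
polynomial from quasi compatibility; by the general theory the value does not depend
on the choice.) -/
def rawYE (α : ℂ) (a b : EW W) (n : ℤ) (w : W) (m : ℤ) : W :=
  if h : QCPair a b then fullYE α h.choose a b w (-n - 1) (-m - 1) else 0

/-- `a(x)_{(α,n)} b(x)`, as an element of `ℰ(W)` whenever the raw family is realized
by one (which is the case for any quasi compatible pair). -/
def YEa (α : ℂˣ) (a b : EW W) (n : ℤ) : EW W :=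
  if h : ∃ c : EW W, ∀ w m, mf c w m = rawYE (α : ℂ) a b n w m then h.choose else 0

/-- `a(x)_n b(x) = a(x)_{(1,n)} b(x)`. -/
def YE (a b : EW W) (n : ℤ) : EW W := YEa 1 a b n

end NVA

namespace NVA

variable {W : Type*} [AddCommGroup W] [Module ℂ W]

/-- Submodules of `ℰ(W)` are `ℂ`-vector spaces (registered explicitly to assist
instance resolution). -/
noncomputable instance (V : Submodule ℂ (EW W)) : AddCommGroup ↥V :=
  @Submodule.addCommGroup ℂ (EW W) _ inferInstance inferInstance V

noncomputable instance (V : Submodule ℂ (EW W)) : Module ℂ ↥V :=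
  @Submodule.module ℂ (EW W) _ inferInstance inferInstance V

/-! ### Derivative and scaling operators on ℰ(W) -/

/-- `D = d/dx` on `ℰ(W)`: `(Da)_m = -m • a_{m-1}`. -/
def Dop (a : EW W) : EW W :=
  ⟨{ toFun := fun w m => (-m : ℂ) • mf a w (m - 1)
     map_add' := by intro w w'; funext m; simp [mf, map_add]
     map_smul' := by
       intro c w; funext m
       simp only [mf, map_smul, Pi.smul_apply, RingHom.id_apply]
       exact smul_comm _ _ _ },
   by
     intro w
     obtain ⟨N, hN⟩ := a.2 w
     exact ⟨N + 1, fun m hm => by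
       have : (a : W →ₗ[ℂ] (ℤ → W)) w (m - 1) = 0 := hN _ (by omega)
       simp [mf, this]⟩⟩

/-- `R_α : a(x) ↦ a(αx)`, on modes `(R_α a)_m = α^{-m-1} a_m`. -/
def RaE (α : ℂˣ) (a : EW W) : EW W :=
  ⟨{ toFun := fun w m => ((α : ℂ) ^ (-m - 1 : ℤ)) • mf a w m
     map_add' := by intro w w'; funext m; simp [mf, map_add]
     map_smul' := by
       intro c w; funext m
       simp only [mf, map_smul, Pi.smul_apply, RingHom.id_apply]
       exact smul_comm _ _ _ },
   by
     intro w
     obtain ⟨N, hN⟩ := a.2 w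
     exact ⟨N, fun m hm => by simp [mf, hN m hm]⟩⟩

/-! ### Nonlocal vertex algebras, modules and quasi modules -/

/-- The coefficient of `x₀^a x₂^b` in `Y₁(u, x₀+x₂) (Y₂(v,x₂) w)`, where
`(x₀+x₂)^m` is expanded in nonnegative powers of `x₂`. -/
def prodCE {V : Type*} (Yo Yi : V → W → ℤ → W) (u v : V) (w : W) (a b : ℤ) : W :=
  ∑ᶠ m : ℤ, if a ≤ m then
    binom m (m - a).toNat • Yo u (Yi v w (-(b - (m - a)) - 1)) (-m - 1) else 0

/-- The coefficient of `x₀^a x₂^b` in `Y₂(Y₁(u,x₀)v, x₂) w`. -/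
def assocCE {V : Type*} (Y1 : V → V → ℤ → V) (Y2 : V → W → ℤ → W)
    (u v : V) (w : W) (a b : ℤ) : W :=
  Y2 (Y1 u v (-a - 1)) w (-b - 1)

/-- Multiplication of a two-variable family (in `x₀, x₂`) by `f(x₀+x₂, x₂)` for a
polynomial `f`, expanding `(x₀+x₂)^d` in nonnegative powers of `x₂`. -/
def mulSubPoly (f : MvPolynomial (Fin 2) ℂ) (A : ℤ → ℤ → W) (a b : ℤ) : W :=
  ∑ d ∈ f.support, ∑ i ∈ Finset.range (d 0 + 1),
    (MvPolynomial.coeff d f * ((d 0).choose i : ℂ)) •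
      A (a - ((d 0 : ℤ) - i)) (b - i - (d 1 : ℤ))

/-- A nonlocal vertex algebra structure on a ℂ-vector space `V`:
a linear map `Y : V → ℰ(V) = Hom(V, V((x)))` and a vacuum vector `1` such that
`Y(1,x)v = v`, `Y(v,x)1 ∈ V[[x]]` with constant term `v`, and weak associativity
holds. -/
structure NLVA (V : Type*) [AddCommGroup V] [Module ℂ V] where
  Y : V →ₗ[ℂ] EW V
  one : V
  vac : ∀ (v : V) (n : ℤ), mf (Y one) v n = if n = -1 then v else 0
  creation0 : ∀ (v : V) (n : ℤ), 0 ≤ n → mf (Y v) one n = 0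
  creation1 : ∀ v : V, mf (Y v) one (-1) = v
  wassoc : ∀ u v w : V, ∃ l : ℕ, ∀ a b : ℤ,
    mulSubPoly (MvPolynomial.X 0 ^ l)
      (prodCE (fun x => mf (Y x)) (fun x => mf (Y x)) u v w) a b =
    mulSubPoly (MvPolynomial.X 0 ^ l)
      (assocCE (fun x y n => mf (Y x) y n) (fun x => mf (Y x)) u v w) a b

/-- The mode maps of a nonlocal vertex algebra: `Yf A u v n = u_n v`. -/
def Yf {V : Type*} [AddCommGroup V] [Module ℂ V] (A : NLVA V) : V → V → ℤ → V :=
  fun u v n => mf (A.Y u) v n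

/-- Mode maps of a linear map `V → ℰ(W)`. -/
def YWf {V : Type*} [AddCommGroup V] [Module ℂ V] (YW : V →ₗ[ℂ] EW W) :
    V → W → ℤ → W := fun v w n => mf (YW v) w n

/-- `(W, Y_W)` is a quasi module for the nonlocal vertex algebra `A` on `V`. -/
def IsQuasiModule {V : Type*} [AddCommGroup V] [Module ℂ V] (A : NLVA V)
    (YW : V →ₗ[ℂ] EW W) : Prop :=
  (∀ (w : W) (n : ℤ), mf (YW A.one) w n = if n = -1 then w else 0) ∧
  ∀ (u v : V) (w : W), ∃ f : MvPolynomial (Fin 2) ℂ, f ≠ 0 ∧ ∀ a b : ℤ,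
    mulSubPoly f (prodCE (YWf YW) (YWf YW) u v w) a b =
    mulSubPoly f (assocCE (Yf A) (YWf YW) u v w) a b

/-- `(W, Y_W)` is a module for the nonlocal vertex algebra `A` on `V`. -/
def IsModule {V : Type*} [AddCommGroup V] [Module ℂ V] (A : NLVA V)
    (YW : V →ₗ[ℂ] EW W) : Prop :=
  (∀ (w : W) (n : ℤ), mf (YW A.one) w n = if n = -1 then w else 0) ∧
  ∀ (u v : V) (w : W), ∃ l : ℕ, ∀ a b : ℤ,
    mulSubPoly (MvPolynomial.X 0 ^ l) (prodCE (YWf YW) (YWf YW) u v w) a b =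
    mulSubPoly (MvPolynomial.X 0 ^ l) (assocCE (Yf A) (YWf YW) u v w) a b

end NVA

namespace NVA

section QuasiCompatiblePairs

variable {W : Type*} [AddCommGroup W] [Module ℂ W]

/-- `W((x))` as a module over `ℂ((x))`. -/
abbrev LM (W : Type*) [AddCommGroup W] [Module ℂ W] : Type _ := HahnModule ℤ ℂ W

/-- `W((x))((x₀))` as a vector space over `ℂ((x))((x₀))`. -/
abbrev LM2 (W : Type*) [AddCommGroup W] [Module ℂ W] : Type _ := HahnModule ℤ LC (LM W)

/-- The coefficient of `x₀^J x^T`. -/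
def cf (y : LM2 W) (J T : ℤ) : W :=
  ((HahnModule.of ℂ).symm (((HahnModule.of LC).symm y).coeff J)).coeff T

theorem cf_ext {y z : LM2 W} (h : ∀ J T, cf y J T = cf z J T) : y = z := by
  apply HahnModule.ext
  funext J
  apply HahnModule.ext
  funext T
  exact h J T

theorem cf_add (y z : LM2 W) (J T : ℤ) : cf (y + z) J T = cf y J T + cf z J T := rfl

theorem coeff_bounded {R : Type*} [Zero R] (x : HahnSeries ℤ R) :
    ∃ N : ℤ, ∀ n < N, x.coeff n = 0 :=
  ⟨x.order, fun _ hn => HahnSeries.coeff_eq_zero_of_lt_order hn⟩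

theorem cf_bounded_outer (y : LM2 W) : ∃ N : ℤ, ∀ J < N, ∀ T, cf y J T = 0 := by
  obtain ⟨N, hN⟩ := coeff_bounded ((HahnModule.of LC).symm y)
  refine ⟨N, fun J hJ T => ?_⟩
  rw [cf, hN J hJ]
  rfl

theorem cf_bounded_inner (y : LM2 W) (J : ℤ) : ∃ N : ℤ, ∀ T < N, cf y J T = 0 :=
  coeff_bounded _

/-- A double family is lower truncated in the sense of `W((x))((x₀))`. -/
def IsIterated (f : ℤ → ℤ → W) : Prop :=
  (∃ N : ℤ, ∀ J < N, ∀ T, f J T = 0) ∧ ∀ J, ∃ N : ℤ, ∀ T < N, f J T = 0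

theorem isIterated_cf (y : LM2 W) : IsIterated (cf y) :=
  ⟨cf_bounded_outer y, cf_bounded_inner y⟩

theorem bddBelow_support {V : Type*} [Zero V] {f : ℤ → V} {N : ℤ} (h : ∀ n < N, f n = 0) :
    BddBelow (Function.support f) :=
  ⟨N, fun _ hn => not_lt.1 fun hlt => hn (h _ hlt)⟩

theorem exists_cf_eq {f : ℤ → ℤ → W} (hf : IsIterated f) : ∃ y : LM2 W, cf y = f := by
  obtain ⟨⟨N, hN⟩, h⟩ := hf
  choose M hM using h
  let g : ℤ → LM W := fun J => HahnModule.of ℂ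
    (HahnSeries.ofSuppBddBelow (f J) (bddBelow_support (hM J)))
  have hg : ∀ J < N, g J = 0 := by
    intro J hJ
    apply HahnModule.ext
    funext T
    exact hN J hJ T
  exact ⟨HahnModule.of LC
    (HahnSeries.ofSuppBddBelow g (bddBelow_support hg)), rfl⟩

/-- The element of `W((x))((x₀))` with prescribed coefficients. -/
def ofCf (f : ℤ → ℤ → W) : LM2 W :=
  if h : IsIterated f then (exists_cf_eq h).choose else 0

theorem cf_ofCf {f : ℤ → ℤ → W} (hf : IsIterated f) (J T : ℤ) : cf (ofCf f) J T = f J T := by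
  rw [ofCf, dif_pos hf, (exists_cf_eq hf).choose_spec]

theorem cf_single_smul (i j : ℤ) (c : ℂ) (y : LM2 W) (J T : ℤ) :
    cf ((HahnSeries.single i (HahnSeries.single j c) : K2) • y) J T
      = c • cf y (J - i) (T - j) := by
  have h1 := HahnModule.coeff_single_smul_vadd (R := LC) (V := LM W) (x := y)
    (r := HahnSeries.single j c) (b := i) (a := J - i)
  have h2 := HahnModule.coeff_single_smul_vadd (R := ℂ) (V := W)
    (x := ((HahnModule.of LC).symm y).coeff (J - i)) (r := c) (b := j) (a := T - j)
  simp only [vadd_eq_add, add_sub_cancel] at h1 h2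
  rw [cf, h1, h2]
  rfl

theorem coeff_smul_eq_finsum {R V : Type*} [Semiring R] [AddCommGroup V] [Module R V]
    (q : HahnSeries ℤ R) (y : HahnModule ℤ R V) (J : ℤ) :
    ((HahnModule.of R).symm (q • y)).coeff J
      = ∑ᶠ i : ℤ, q.coeff i • ((HahnModule.of R).symm y).coeff (J - i) := by
  rw [HahnModule.coeff_smul]
  symm
  rw [finsum_eq_sum_of_support_subset (s := (Finset.VAddAntidiagonal J
    (Set.VAddAntidiagonal.finite_of_isPWO q.isPWO_support
      ((HahnModule.of R).symm y).isPWO_support J)).image Prod.fst)]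
  · rw [Finset.sum_image]
    · refine Finset.sum_congr rfl fun ij hij => ?_
      rw [Finset.mem_vaddAntidiagonal, vadd_eq_add] at hij
      rw [← hij.2.2, add_sub_cancel_left]
    · intro x hx z hz hxz
      simp only [Finset.mem_coe, Finset.mem_vaddAntidiagonal, vadd_eq_add] at hx hz
      exact Prod.ext hxz (by omega)
  · intro i hi
    simp only [Finset.coe_image, Set.mem_image, Finset.mem_coe, Finset.mem_vaddAntidiagonal]
    refine ⟨(i, J - i), ⟨?_, ?_, by simp⟩, rfl⟩
    · intro h0
      exact hi (by simp [h0])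
    · intro h0
      exact hi (by simp [h0])

theorem coeff_ne_zero_finite {R V : Type*} [Zero R] [Zero V]
    (q : HahnSeries ℤ R) (y : HahnSeries ℤ V) (J : ℤ) :
    {i : ℤ | q.coeff i ≠ 0 ∧ y.coeff (J - i) ≠ 0}.Finite := by
  obtain ⟨A, hA⟩ := coeff_bounded q
  obtain ⟨B, hB⟩ := coeff_bounded y
  refine (Set.finite_Icc A (J - B)).subset fun i hi => ⟨?_, ?_⟩
  · by_contra hcon
    exact hi.1 (hA i (by omega))
  · by_contra hcon
    exact hi.2 (hB (J - i) (by omega))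

theorem cf_smul (q : K2) (y : LM2 W) (J T : ℤ) :
    cf (q • y) J T = ∑ᶠ s : ℤ × ℤ, (q.coeff s.1).coeff s.2 • cf y (J - s.1) (T - s.2) := by
  have hout := coeff_ne_zero_finite q ((HahnModule.of LC).symm y) J
  rw [finsum_curry]
  · have h1 := AddMonoidHom.map_finsum
      (HahnSeries.coeff.addMonoidHom T : HahnSeries ℤ W →+ W) (f := fun i : ℤ =>
      (HahnModule.of ℂ).symm (q.coeff i • ((HahnModule.of LC).symm y).coeff (J - i)))
      (hout.subset fun i hi => ⟨fun h0 => hi ?_, fun h0 => hi ?_⟩)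
    · refine (congrArg (fun z : LM W => ((HahnModule.of ℂ).symm z).coeff T)
        (coeff_smul_eq_finsum q y J)).trans (h1.trans (finsum_congr fun i => ?_))
      exact coeff_smul_eq_finsum _ _ _
    · simp only [h0]
      exact zero_smul LC (_ : LM W)
    · simp only [h0]
      exact smul_zero (A := LM W) (_ : LC)
  · refine (Set.Finite.biUnion hout fun i _ => Set.Finite.image (Prod.mk i)
      (coeff_ne_zero_finite (q.coeff i)
        ((HahnModule.of ℂ).symm (((HahnModule.of LC).symm y).coeff (J - i))) T)).subset ?_
    rintro ⟨i, j⟩ hij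
    have hij' : (q.coeff i).coeff j • cf y (J - i) (T - j) ≠ 0 := hij
    have hq : (q.coeff i).coeff j ≠ 0 := fun h0 => hij' (by rw [h0, zero_smul])
    have hy : cf y (J - i) (T - j) ≠ 0 := fun h0 => hij' (by rw [h0, smul_zero])
    simp only [Set.mem_iUnion, Set.mem_image]
    refine ⟨i, ⟨fun h0 => hq ?_, fun h0 => hy ?_⟩, j, ⟨hq, hy⟩, rfl⟩
    · rw [h0, HahnSeries.coeff_zero]
    · rw [cf, h0]
      rfl

section PolynomialAction

theorem end_add_apply {M : Type*} [AddCommGroup M] (f g : AddMonoid.End M) (y : M) :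
    (f + g) y = f y + g y := rfl

theorem end_mul_apply {M : Type*} [AddCommGroup M] (f g : AddMonoid.End M) (y : M) :
    (f * g) y = f (g y) := rfl

variable {M N : Type*} [AddCommGroup M] [AddCommGroup N]

/-- A map intertwines two actions of the polynomial ring on a stable subgroup as soon as it
intertwines the actions of constants and variables. -/
theorem intertwine_of_generators (act : MvPolynomial (Fin 2) ℂ →+* AddMonoid.End M)
    (act' : MvPolynomial (Fin 2) ℂ →+* AddMonoid.End N) (S : AddSubgroup M)
    (hS : ∀ p, ∀ y ∈ S, act p y ∈ S) (φ : M → N)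
    (hadd : ∀ y ∈ S, ∀ z ∈ S, φ (y + z) = φ y + φ z)
    (hC : ∀ c, ∀ y ∈ S, φ (act (MvPolynomial.C c) y) = act' (MvPolynomial.C c) (φ y))
    (hX : ∀ i, ∀ y ∈ S, φ (act (MvPolynomial.X i) y) = act' (MvPolynomial.X i) (φ y))
    (p : MvPolynomial (Fin 2) ℂ) : ∀ y ∈ S, φ (act p y) = act' p (φ y) := by
  induction p using MvPolynomial.induction_on with
  | C c => exact hC c
  | add p q hp hq =>
    intro y hy
    rw [map_add, map_add, end_add_apply, end_add_apply,
      hadd _ (hS p y hy) _ (hS q y hy), hp y hy, hq y hy]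
  | mul_X p i hp =>
    intro y hy
    rw [map_mul, map_mul, end_mul_apply, end_mul_apply,
      hp _ (hS _ y hy), hX i y hy]

/-- An additive map satisfies the Leibniz rule with respect to a partial derivative as soon as
it does so for constants and variables. -/
theorem leibniz_of_generators (act : MvPolynomial (Fin 2) ℂ →+* AddMonoid.End M) (δ : M →+ M)
    (i : Fin 2)
    (hC : ∀ c y, δ (act (MvPolynomial.C c) y) = act (MvPolynomial.C c) (δ y))
    (hX : ∀ j y, δ (act (MvPolynomial.X j) y)
      = act (MvPolynomial.pderiv i (MvPolynomial.X j)) y + act (MvPolynomial.X j) (δ y))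
    (p : MvPolynomial (Fin 2) ℂ) :
    ∀ y, δ (act p y) = act (MvPolynomial.pderiv i p) y + act p (δ y) := by
  induction p using MvPolynomial.induction_on with
  | C c => intro y; simp [hC]
  | add p q hp hq =>
    intro y
    simp only [map_add, end_add_apply, hp, hq]
    abel
  | mul_X p j hp =>
    intro y
    simp only [Derivation.leibniz, smul_eq_mul, map_add, map_mul, end_mul_apply,
      end_add_apply, hp, hX]
    rw [← end_mul_apply (act (MvPolynomial.X j)) (act (MvPolynomial.pderiv i p)),
      ← map_mul, mul_comm, map_mul, end_mul_apply]
    abel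

end PolynomialAction

theorem mulPoly_apply (p : MvPolynomial (Fin 2) ℂ) (F : ℤ → ℤ → W) (m t : ℤ) :
    mulPoly p F m t
      = Finsupp.sum (AddMonoidAlgebra.coeff p) (fun d c => c • F (m - d 0) (t - d 1)) := rfl

theorem mulPoly_add_left (p q : MvPolynomial (Fin 2) ℂ) (F : ℤ → ℤ → W) :
    mulPoly (p + q) F = mulPoly p F + mulPoly q F := by
  funext m t
  simp only [Pi.add_apply, mulPoly_apply]
  exact Finsupp.sum_add_index' (by simp) (by simp [add_smul])

theorem mulPoly_monomial (d : Fin 2 →₀ ℕ) (c : ℂ) (F : ℤ → ℤ → W) (m t : ℤ) :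
    mulPoly (MvPolynomial.monomial d c) F m t = c • F (m - d 0) (t - d 1) := by
  rw [mulPoly_apply]
  exact Finsupp.sum_single_index (by simp)

theorem mulPoly_zero_left (F : ℤ → ℤ → W) : mulPoly 0 F = 0 := by
  funext m t
  simp [mulPoly]

theorem mulPoly_C (c : ℂ) (F : ℤ → ℤ → W) : mulPoly (MvPolynomial.C c) F = c • F := by
  funext m t
  rw [MvPolynomial.C_apply, mulPoly_monomial]
  simp

theorem mulPoly_X_zero (F : ℤ → ℤ → W) :
    mulPoly (MvPolynomial.X 0) F = fun m t => F (m - 1) t := by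
  funext m t
  rw [MvPolynomial.X, mulPoly_monomial]
  simp

theorem mulPoly_X_one (F : ℤ → ℤ → W) :
    mulPoly (MvPolynomial.X 1) F = fun m t => F m (t - 1) := by
  funext m t
  rw [MvPolynomial.X, mulPoly_monomial]
  simp

theorem mulPoly_add_right (p : MvPolynomial (Fin 2) ℂ) (F G : ℤ → ℤ → W) :
    mulPoly p (F + G) = mulPoly p F + mulPoly p G := by
  funext m t
  simp [mulPoly, Finset.sum_add_distrib]

theorem mulPoly_mul (p q : MvPolynomial (Fin 2) ℂ) (F : ℤ → ℤ → W) :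
    mulPoly (p * q) F = mulPoly p (mulPoly q F) := by
  induction p using MvPolynomial.induction_on' with
  | add p p' hp hp' => rw [add_mul, mulPoly_add_left, mulPoly_add_left, hp, hp']
  | monomial d c =>
    induction q using MvPolynomial.induction_on' with
    | add q q' hq hq' =>
      rw [mul_add, mulPoly_add_left, mulPoly_add_left, mulPoly_add_right, hq, hq']
    | monomial e c' =>
      funext m t
      simp only [MvPolynomial.monomial_mul, mulPoly_monomial, smul_smul, Finsupp.add_apply,
        Nat.cast_add, sub_sub]

/-- `mulPoly` as a ring action. -/
def mulPolyHom (W : Type*) [AddCommGroup W] [Module ℂ W] :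
    MvPolynomial (Fin 2) ℂ →+* AddMonoid.End (ℤ → ℤ → W) where
  toFun p := AddMonoidHom.mk' (mulPoly p) (mulPoly_add_right p)
  map_one' := by
    ext F : 1
    have := mulPoly_C 1 F
    rwa [MvPolynomial.C_1, one_smul] at this
  map_zero' := by
    ext F : 1
    exact mulPoly_zero_left F
  map_add' p q := by
    ext F : 1
    exact mulPoly_add_left p q F
  map_mul' p q := by
    ext F : 1
    exact mulPoly_mul p q F

theorem mulPolyHom_apply (p : MvPolynomial (Fin 2) ℂ) (F : ℤ → ℤ → W) :
    mulPolyHom W p F = mulPoly p F := rfl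

/-- `W((x₁,x₂))`. -/
def laurent2 (W : Type*) [AddCommGroup W] [Module ℂ W] : AddSubgroup (ℤ → ℤ → W) where
  carrier := {F | IsLaurent2 F}
  zero_mem' := ⟨0, fun _ _ _ => rfl⟩
  add_mem' := by
    rintro F G ⟨N, hN⟩ ⟨M, hM⟩
    refine ⟨min N M, fun m t h => ?_⟩
    rw [Pi.add_apply, Pi.add_apply, hN m t (by omega), hM m t (by omega), add_zero]
  neg_mem' := by
    rintro F ⟨N, hN⟩
    exact ⟨N, fun m t h => by rw [Pi.neg_apply, Pi.neg_apply, hN m t h, neg_zero]⟩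

theorem isLaurent2_mulPoly (p : MvPolynomial (Fin 2) ℂ) {F : ℤ → ℤ → W} (hF : IsLaurent2 F) :
    IsLaurent2 (mulPoly p F) := by
  obtain ⟨N, hN⟩ := hF
  refine ⟨N, fun m t h => Finset.sum_eq_zero fun d _ => ?_⟩
  rw [hN _ _ (by omega), smul_zero]

/-- The action of polynomials on `W((x))((x₀))` through the substitution
`x₁ = x₀ + αx`, `x₂ = x`. -/
def qKHom (W : Type*) [AddCommGroup W] [Module ℂ W] (α : ℂ) :
    MvPolynomial (Fin 2) ℂ →+* AddMonoid.End (LM2 W) :=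
  (Module.toAddMonoidEnd K2 (LM2 W)).comp
    (MvPolynomial.aeval ![xOuter + xInnerC α, xInner] : MvPolynomial (Fin 2) ℂ →ₐ[ℂ] K2).toRingHom

theorem qKHom_apply (α : ℂ) (p : MvPolynomial (Fin 2) ℂ) (y : LM2 W) :
    qKHom W α p y = qK p α • y := rfl

theorem qK_mul (p q : MvPolynomial (Fin 2) ℂ) (α : ℂ) : qK (p * q) α = qK p α * qK q α :=
  map_mul _ _ _

theorem aeval_K2_C (v : Fin 2 → K2) (c : ℂ) :
    MvPolynomial.aeval v (MvPolynomial.C c) = HahnSeries.single 0 (HahnSeries.single 0 c) := by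
  refine (MvPolynomial.aeval_C v c).trans ?_
  rw [HahnSeries.algebraMap_apply', PowerSeries.algebraMap_apply, HahnSeries.ofPowerSeries_C,
    HahnSeries.algebraMap_apply', PowerSeries.algebraMap_apply, HahnSeries.ofPowerSeries_C]
  rfl

theorem K2_add_smul (q r : K2) (y : LM2 W) : (q + r) • y = q • y + r • y := add_smul q r y

theorem cf_qK_C_smul (α c : ℂ) (y : LM2 W) (J T : ℤ) :
    cf (qK (MvPolynomial.C c) α • y) J T = c • cf y J T := by
  rw [qK, aeval_K2_C, cf_single_smul, sub_zero, sub_zero]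

theorem cf_qK_X_zero_smul (α : ℂ) (y : LM2 W) (J T : ℤ) :
    cf (qK (MvPolynomial.X 0) α • y) J T = cf y (J - 1) T + α • cf y J (T - 1) := by
  have h1 : (xOuter : K2) = HahnSeries.single 1 (HahnSeries.single 0 1) := rfl
  rw [qK, MvPolynomial.aeval_X, Matrix.cons_val_zero, K2_add_smul, cf_add, h1, xInnerC,
    cf_single_smul, cf_single_smul, one_smul, sub_zero, sub_zero]

theorem cf_qK_X_one_smul (α : ℂ) (y : LM2 W) (J T : ℤ) :
    cf (qK (MvPolynomial.X 1) α • y) J T = cf y J (T - 1) := by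
  rw [qK, MvPolynomial.aeval_X, Matrix.cons_val_one, Matrix.cons_val_zero, xInner,
    cf_single_smul, one_smul, sub_zero]

theorem aeval_K2_X_pow (v : Fin 2 → K2) (i : Fin 2) (n : ℕ) (j k : ℤ)
    (h : v i = HahnSeries.single j (HahnSeries.single k 1)) :
    MvPolynomial.aeval v ((MvPolynomial.X i : MvPolynomial (Fin 2) ℂ) ^ n)
      = HahnSeries.single (n * j) (HahnSeries.single (n * k) 1) := by
  induction n with
  | zero =>
    rw [pow_zero, ← MvPolynomial.C_1, aeval_K2_C, Nat.cast_zero, zero_mul, zero_mul]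
  | succ n ih =>
    have hX := MvPolynomial.aeval_X (R := ℂ) v i
    rw [pow_succ, map_mul, ih, hX, h, HahnSeries.single_mul_single,
      HahnSeries.single_mul_single, one_mul]
    congr 2 <;> push_cast <;> ring_nf

theorem aeval_outer_inner_coeff (p : MvPolynomial (Fin 2) ℂ) (d : Fin 2 →₀ ℕ) :
    ((MvPolynomial.aeval ![xOuter, xInner] p).coeff (d 0)).coeff (d 1)
      = MvPolynomial.coeff d p := by
  induction p using MvPolynomial.induction_on' with
  | add p q hp hq =>
    rw [map_add, HahnSeries.coeff_add, HahnSeries.coeff_add, hp, hq, MvPolynomial.coeff_add]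
  | monomial e c =>
    rw [MvPolynomial.coeff_monomial, MvPolynomial.monomial_eq, map_mul, aeval_K2_C,
      Finsupp.prod_fintype _ _ (fun _ => pow_zero _), Fin.prod_univ_two, map_mul,
      aeval_K2_X_pow _ 0 _ 1 0 rfl, aeval_K2_X_pow _ 1 _ 0 1 rfl]
    simp only [HahnSeries.single_mul_single, mul_zero, zero_add, add_zero, mul_one]
    have hde : e = d ↔ (d 0 : ℤ) = e 0 ∧ (d 1 : ℤ) = e 1 := by
      constructor
      · rintro rfl
        exact ⟨rfl, rfl⟩
      · rintro ⟨h0, h1⟩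
        ext k
        fin_cases k
        · exact_mod_cast h0.symm
        · exact_mod_cast h1.symm
    rw [HahnSeries.coeff_single]
    by_cases h0 : (d 0 : ℤ) = e 0
    · rw [if_pos h0, HahnSeries.coeff_single]
      simp only [hde, h0, true_and]
      split_ifs <;> rfl
    · rw [if_neg h0, if_neg (fun h => h0 (hde.1 h).1), HahnSeries.coeff_zero]

theorem qK_ne_zero {p : MvPolynomial (Fin 2) ℂ} (hp : p ≠ 0) (α : ℂ) : qK p α ≠ 0 := by
  let f : MvPolynomial (Fin 2) ℂ →ₐ[ℂ] MvPolynomial (Fin 2) ℂ := MvPolynomial.aeval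
    ![MvPolynomial.X 0 + MvPolynomial.C α * MvPolynomial.X 1, MvPolynomial.X 1]
  let g : MvPolynomial (Fin 2) ℂ →ₐ[ℂ] MvPolynomial (Fin 2) ℂ := MvPolynomial.aeval
    ![MvPolynomial.X 0 - MvPolynomial.C α * MvPolynomial.X 1, MvPolynomial.X 1]
  have hgf : g.comp f = AlgHom.id ℂ _ := by
    ext k : 1
    fin_cases k <;> simp [f, g, MvPolynomial.algebraMap_eq]
  have hqf : (MvPolynomial.aeval ![xOuter, xInner]).comp f
      = (MvPolynomial.aeval ![xOuter + xInnerC α, xInner] : _ →ₐ[ℂ] K2) := by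
    ext k : 1
    fin_cases k
    · have h : (MvPolynomial.aeval ![xOuter, xInner]) (MvPolynomial.C α) * xInner
          = xInnerC α := by
        rw [aeval_K2_C, xInner, xInnerC, HahnSeries.single_mul_single,
          HahnSeries.single_mul_single, zero_add, zero_add, mul_one]
      simp only [f, AlgHom.comp_apply, MvPolynomial.aeval_X, map_add, map_mul, Fin.zero_eta,
        Matrix.cons_val_zero, Matrix.cons_val_one, h]
    · simp [f]
  have hfp : f p ≠ 0 := fun h0 => hp <| by
    rw [← AlgHom.id_apply (R := ℂ) p, ← hgf, AlgHom.comp_apply, h0, map_zero]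
  obtain ⟨d, hd⟩ := MvPolynomial.ne_zero_iff.1 hfp
  intro h0
  rw [qK, ← hqf, AlgHom.comp_apply] at h0
  rw [← aeval_outer_inner_coeff, h0] at hd
  exact hd rfl

section Binomial

/-- The generalized binomial coefficient with an integral lower index. -/
def binomZ (m J : ℤ) : ℂ := if 0 ≤ J then binom m J.toNat else 0

theorem binomZ_of_neg (m : ℤ) {J : ℤ} (h : J < 0) : binomZ m J = 0 := if_neg (by omega)

theorem binomZ_natCast (m : ℤ) (j : ℕ) : binomZ m j = binom m j := by
  rw [binomZ, if_pos (Int.natCast_nonneg j), Int.toNat_natCast]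

theorem binom_zero (m : ℤ) : binom m 0 = 1 := by simp [binom]

theorem succ_mul_binom_succ (m : ℤ) (j : ℕ) :
    ((j : ℂ) + 1) * binom m (j + 1) = (m - j) * binom m j := by
  have h1 : (j.factorial : ℂ) ≠ 0 := Nat.cast_ne_zero.2 j.factorial_ne_zero
  have h2 : (j : ℂ) + 1 ≠ 0 := Nat.cast_add_one_ne_zero j
  rw [binom, binom, Finset.prod_range_succ, Nat.factorial_succ]
  push_cast
  field_simp

theorem prod_add_one_sub (x : ℂ) (j : ℕ) :
    ∏ i ∈ Finset.range (j + 1), (x + 1 - (i : ℂ))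
      = (x + 1) * ∏ i ∈ Finset.range j, (x - (i : ℂ)) := by
  rw [Finset.prod_range_succ', mul_comm]
  congr 1
  · simp
  · exact Finset.prod_congr rfl fun i _ => by push_cast; ring

theorem succ_mul_binom_succ_succ (m : ℤ) (j : ℕ) :
    ((j : ℂ) + 1) * binom (m + 1) (j + 1) = (m + 1) * binom m j := by
  have h1 : (j.factorial : ℂ) ≠ 0 := Nat.cast_ne_zero.2 j.factorial_ne_zero
  have h2 : (j : ℂ) + 1 ≠ 0 := Nat.cast_add_one_ne_zero j
  rw [binom, binom, Nat.factorial_succ]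
  push_cast
  rw [prod_add_one_sub]
  field_simp

theorem binom_succ_succ (m : ℤ) (j : ℕ) :
    binom (m + 1) (j + 1) = binom m (j + 1) + binom m j := by
  have h2 : (j : ℂ) + 1 ≠ 0 := Nat.cast_add_one_ne_zero j
  apply mul_left_cancel₀ h2
  rw [mul_add, succ_mul_binom_succ_succ, succ_mul_binom_succ]
  ring

theorem int_cases_succ (J : ℤ) : J < 0 ∨ J = 0 ∨ ∃ j : ℕ, J = (j : ℤ) + 1 := by
  rcases lt_trichotomy J 0 with h | h | h
  · exact Or.inl h
  · exact Or.inr (Or.inl h)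
  · exact Or.inr (Or.inr ⟨(J - 1).toNat, by omega⟩)

theorem binomZ_pascal (m J : ℤ) : binomZ (m + 1) J = binomZ m J + binomZ m (J - 1) := by
  rcases int_cases_succ J with h | rfl | ⟨j, rfl⟩
  · rw [binomZ_of_neg _ h, binomZ_of_neg _ h, binomZ_of_neg _ (by omega), add_zero]
  · rw [binomZ_of_neg _ (J := 0 - 1) (by omega), add_zero]
    exact (binomZ_natCast _ 0).trans ((binom_zero _).trans
      ((binom_zero _).symm.trans (binomZ_natCast _ 0).symm))
  · rw [add_sub_cancel_right, ← Nat.cast_succ, binomZ_natCast, binomZ_natCast, binomZ_natCast,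
      binom_succ_succ]

theorem succ_mul_binomZ_succ (m J : ℤ) :
    ((J : ℂ) + 1) * binomZ m (J + 1) = (m - J) * binomZ m J := by
  rcases lt_or_ge J 0 with h | h
  · rw [binomZ_of_neg m h, mul_zero]
    rcases eq_or_ne J (-1) with rfl | h'
    · simp
    · rw [binomZ_of_neg _ (by omega), mul_zero]
  · lift J to ℕ using h
    rw [← Nat.cast_succ, binomZ_natCast, binomZ_natCast, Int.cast_natCast, succ_mul_binom_succ]

theorem succ_mul_binomZ_succ_succ (m J : ℤ) :
    ((J : ℂ) + 1) * binomZ (m + 1) (J + 1) = (m + 1) * binomZ m J := by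
  rcases lt_or_ge J 0 with h | h
  · rw [binomZ_of_neg m h, mul_zero]
    rcases eq_or_ne J (-1) with rfl | h'
    · simp
    · rw [binomZ_of_neg _ (by omega), mul_zero]
  · lift J to ℕ using h
    rw [← Nat.cast_succ, binomZ_natCast, binomZ_natCast, Int.cast_natCast,
      succ_mul_binom_succ_succ]

end Binomial

section Substitution

/-- The summands of the coefficient of `x₀^J x^T` in `F(αx + x₀, x)`. -/
def substTerm (α : ℂ) (F : ℤ → ℤ → W) (J T m : ℤ) : W :=
  (binomZ m J * α ^ (m - J)) • F m (T - m + J)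

/-- The coefficient of `x₀^J x^T` in `F(αx + x₀, x)`. -/
def substCoeff (α : ℂ) (F : ℤ → ℤ → W) (J T : ℤ) : W := ∑ᶠ m : ℤ, substTerm α F J T m

/-- The substitution `x₁ = αx + x₀`, `x₂ = x`. -/
def subst (α : ℂ) (F : ℤ → ℤ → W) : LM2 W := ofCf (substCoeff α F)

variable {α : ℂ} {F G : ℤ → ℤ → W}

theorem substTerm_support_finite (α : ℂ) (hF : IsLaurent2 F) (J T : ℤ) :
    (Function.support (substTerm α F J T)).Finite := by
  obtain ⟨N, hN⟩ := hF
  refine (Set.finite_Icc N (T + J - N)).subset fun m hm => ?_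
  by_contra hcon
  rw [Set.mem_Icc] at hcon
  exact hm (by rw [substTerm, hN _ _ (by omega), smul_zero])

theorem isIterated_substCoeff (α : ℂ) (hF : IsLaurent2 F) : IsIterated (substCoeff α F) := by
  obtain ⟨N, hN⟩ := hF
  refine ⟨⟨0, fun J hJ T => ?_⟩, fun J => ⟨2 * N - J, fun T hT => ?_⟩⟩
  · exact finsum_eq_zero_of_forall_eq_zero fun m => by
      rw [substTerm, binomZ_of_neg m hJ, zero_mul, zero_smul]
  · exact finsum_eq_zero_of_forall_eq_zero fun m => by
      rw [substTerm, hN _ _ (by omega), smul_zero]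

theorem cf_subst (α : ℂ) (hF : IsLaurent2 F) (J T : ℤ) :
    cf (subst α F) J T = substCoeff α F J T :=
  cf_ofCf (isIterated_substCoeff α hF) J T

theorem finsum_shift {V : Type*} [AddCommMonoid V] (f : ℤ → V) :
    ∑ᶠ m, f m = ∑ᶠ m, f (m + 1) :=
  (finsum_comp_equiv (Equiv.addRight (1 : ℤ))).symm

theorem subst_add (α : ℂ) (hF : IsLaurent2 F) (hG : IsLaurent2 G) :
    subst α (F + G) = subst α F + subst α G := by
  apply cf_ext
  intro J T
  rw [cf_add, cf_subst α ((laurent2 W).add_mem hF hG), cf_subst α hF, cf_subst α hG,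
    substCoeff, substCoeff, substCoeff, ← finsum_add_distrib
      (substTerm_support_finite α hF J T) (substTerm_support_finite α hG J T)]
  exact finsum_congr fun m => smul_add _ _ _

theorem subst_mulPoly_C (α c : ℂ) (hF : IsLaurent2 F) :
    subst α (mulPoly (MvPolynomial.C c) F) = qK (MvPolynomial.C c) α • subst α F := by
  apply cf_ext
  intro J T
  rw [cf_subst α (isLaurent2_mulPoly _ hF), cf_qK_C_smul, cf_subst α hF, mulPoly_C,
    substCoeff, substCoeff, smul_finsum]
  exact finsum_congr fun m => smul_comm _ _ _

theorem support_smul_finite {ι : Type*} (c : ℂ) {f : ι → W} (h : (Function.support f).Finite) :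
    (Function.support fun m => c • f m).Finite :=
  h.subset (Function.support_const_smul_subset c f)

theorem subst_mulPoly_X_zero (hα : α ≠ 0) (hF : IsLaurent2 F) :
    subst α (mulPoly (MvPolynomial.X 0) F) = qK (MvPolynomial.X 0) α • subst α F := by
  apply cf_ext
  intro J T
  rw [cf_subst α (isLaurent2_mulPoly _ hF), cf_qK_X_zero_smul, cf_subst α hF, cf_subst α hF,
    mulPoly_X_zero, substCoeff, substCoeff, substCoeff, smul_finsum, ← finsum_add_distrib
      (substTerm_support_finite α hF _ _)
      (support_smul_finite _ (substTerm_support_finite α hF _ _)),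
    finsum_shift]
  refine finsum_congr fun m => ?_
  have h1 : T - m + (J - 1) = T - (m + 1) + J := by ring
  have h2 : T - 1 - m + J = T - (m + 1) + J := by ring
  simp only [substTerm, add_sub_cancel_right, h1, h2, smul_smul, ← add_smul]
  congr 1
  have h3 : m + 1 - J = m - J + 1 := by ring
  have h4 : m - (J - 1) = m - J + 1 := by ring
  rw [binomZ_pascal, h3, h4, zpow_add_one₀ hα]
  ring

theorem subst_mulPoly_X_one (α : ℂ) (hF : IsLaurent2 F) :
    subst α (mulPoly (MvPolynomial.X 1) F) = qK (MvPolynomial.X 1) α • subst α F := by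
  apply cf_ext
  intro J T
  rw [cf_subst α (isLaurent2_mulPoly _ hF), cf_qK_X_one_smul, cf_subst α hF, mulPoly_X_one,
    substCoeff, substCoeff]
  refine finsum_congr fun m => ?_
  have h1 : T - m + J - 1 = T - 1 - m + J := by ring
  simp only [substTerm, h1]

theorem subst_mulPoly (hα : α ≠ 0) (hF : IsLaurent2 F) (p : MvPolynomial (Fin 2) ℂ) :
    subst α (mulPoly p F) = qK p α • subst α F := by
  refine intertwine_of_generators (mulPolyHom W) (qKHom W α) (laurent2 W)
    (fun p y hy => isLaurent2_mulPoly p hy) (subst α) (fun y hy z hz => subst_add α hy hz)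
    (fun c y hy => subst_mulPoly_C α c hy) (fun i y hy => ?_) p F hF
  fin_cases i
  · exact subst_mulPoly_X_zero hα hy
  · exact subst_mulPoly_X_one α hy

end Substitution

section Derivatives

/-- `∂/∂x₁`. -/
def derivFst (W : Type*) [AddCommGroup W] [Module ℂ W] : (ℤ → ℤ → W) →+ (ℤ → ℤ → W) where
  toFun F m t := ((m : ℂ) + 1) • F (m + 1) t
  map_zero' := by funext m t; exact smul_zero _
  map_add' F G := by funext m t; exact smul_add _ _ _

/-- `∂/∂x₂`. -/
def derivSnd (W : Type*) [AddCommGroup W] [Module ℂ W] : (ℤ → ℤ → W) →+ (ℤ → ℤ → W) where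
  toFun F m t := ((t : ℂ) + 1) • F m (t + 1)
  map_zero' := by funext m t; exact smul_zero _
  map_add' F G := by funext m t; exact smul_add _ _ _

theorem derivFst_apply (F : ℤ → ℤ → W) (m t : ℤ) :
    derivFst W F m t = ((m : ℂ) + 1) • F (m + 1) t := rfl

theorem derivSnd_apply (F : ℤ → ℤ → W) (m t : ℤ) :
    derivSnd W F m t = ((t : ℂ) + 1) • F m (t + 1) := rfl

theorem isLaurent2_derivFst {F : ℤ → ℤ → W} (hF : IsLaurent2 F) : IsLaurent2 (derivFst W F) := by
  obtain ⟨N, hN⟩ := hF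
  exact ⟨N - 1, fun m t h => by rw [derivFst_apply, hN _ _ (by omega), smul_zero]⟩

theorem isLaurent2_derivSnd {F : ℤ → ℤ → W} (hF : IsLaurent2 F) : IsLaurent2 (derivSnd W F) := by
  obtain ⟨N, hN⟩ := hF
  exact ⟨N - 1, fun m t h => by rw [derivSnd_apply, hN _ _ (by omega), smul_zero]⟩

theorem isIterated_derivFst {f : ℤ → ℤ → W} (hf : IsIterated f) : IsIterated (derivFst W f) := by
  obtain ⟨⟨N, hN⟩, h⟩ := hf
  refine ⟨⟨N - 1, fun J hJ T => by rw [derivFst_apply, hN _ (by omega), smul_zero]⟩, fun J => ?_⟩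
  obtain ⟨M, hM⟩ := h (J + 1)
  exact ⟨M, fun T hT => by rw [derivFst_apply, hM T hT, smul_zero]⟩

theorem isIterated_derivSnd {f : ℤ → ℤ → W} (hf : IsIterated f) : IsIterated (derivSnd W f) := by
  obtain ⟨⟨N, hN⟩, h⟩ := hf
  refine ⟨⟨N, fun J hJ T => by rw [derivSnd_apply, hN _ hJ, smul_zero]⟩, fun J => ?_⟩
  obtain ⟨M, hM⟩ := h J
  exact ⟨M - 1, fun T hT => by rw [derivSnd_apply, hM _ (by omega), smul_zero]⟩

/-- The endomorphism of `W((x))((x₀))` given by an operation on coefficients. -/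
def liftCf (Φ : (ℤ → ℤ → W) →+ (ℤ → ℤ → W)) (h : ∀ f, IsIterated f → IsIterated (Φ f)) :
    LM2 W →+ LM2 W :=
  AddMonoidHom.mk' (fun y => ofCf (Φ (cf y))) fun y z => by
    apply cf_ext
    intro J T
    rw [cf_add, cf_ofCf (h _ (isIterated_cf _)), cf_ofCf (h _ (isIterated_cf _)),
      cf_ofCf (h _ (isIterated_cf _))]
    exact congrFun (congrFun (map_add Φ (cf y) (cf z)) J) T

theorem cf_liftCf (Φ : (ℤ → ℤ → W) →+ (ℤ → ℤ → W)) (h : ∀ f, IsIterated f → IsIterated (Φ f))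
    (y : LM2 W) (J T : ℤ) : cf (liftCf Φ h y) J T = Φ (cf y) J T :=
  cf_ofCf (h _ (isIterated_cf y)) J T

/-- `∂/∂x₀` on `W((x))((x₀))`. -/
def outerDeriv (W : Type*) [AddCommGroup W] [Module ℂ W] : LM2 W →+ LM2 W :=
  liftCf (derivFst W) fun _ => isIterated_derivFst

/-- `∂/∂x - α ∂/∂x₀` on `W((x))((x₀))`. -/
def mixedDeriv (W : Type*) [AddCommGroup W] [Module ℂ W] (α : ℂ) : LM2 W →+ LM2 W :=
  liftCf (AddMonoidHom.mk' (fun f => derivSnd W f - α • derivFst W f)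
      fun f g => by rw [map_add, map_add, smul_add, add_sub_add_comm])
    fun f hf => by
      obtain ⟨⟨N, hN⟩, h⟩ := isIterated_derivFst hf
      obtain ⟨⟨N', hN'⟩, h'⟩ := isIterated_derivSnd hf
      refine ⟨⟨min N N', fun J hJ T => ?_⟩, fun J => ?_⟩
      · change derivSnd W f J T - α • derivFst W f J T = 0
        rw [hN J (by omega), hN' J (by omega), smul_zero, sub_zero]
      · obtain ⟨M, hM⟩ := h J
        obtain ⟨M', hM'⟩ := h' J
        refine ⟨min M M', fun T hT => ?_⟩
        change derivSnd W f J T - α • derivFst W f J T = 0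
        rw [hM T (by omega), hM' T (by omega), smul_zero, sub_zero]

theorem cf_outerDeriv (y : LM2 W) (J T : ℤ) :
    cf (outerDeriv W y) J T = ((J : ℂ) + 1) • cf y (J + 1) T :=
  cf_liftCf _ _ y J T

theorem cf_mixedDeriv (α : ℂ) (y : LM2 W) (J T : ℤ) :
    cf (mixedDeriv W α y) J T
      = ((T : ℂ) + 1) • cf y J (T + 1) - α • ((J : ℂ) + 1) • cf y (J + 1) T :=
  cf_liftCf _ _ y J T

theorem mulPoly_leibniz_fst (p : MvPolynomial (Fin 2) ℂ) (F : ℤ → ℤ → W) :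
    derivFst W (mulPoly p F)
      = mulPoly (MvPolynomial.pderiv 0 p) F + mulPoly p (derivFst W F) := by
  refine leibniz_of_generators (mulPolyHom W) (derivFst W) 0 (fun c F => ?_) (fun j F => ?_) p F
  · simp only [mulPolyHom_apply, mulPoly_C]
    funext m t
    exact smul_comm _ _ _
  · simp only [mulPolyHom_apply]
    fin_cases j
    · have h := mulPoly_C 1 F
      rw [MvPolynomial.C_1, one_smul] at h
      simp only [Fin.zero_eta, MvPolynomial.pderiv_X_self, h, mulPoly_X_zero]
      funext m t
      simp only [derivFst_apply, Pi.add_apply, sub_add_cancel, add_sub_cancel_right]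
      push_cast
      module
    · simp only [Fin.mk_one, MvPolynomial.pderiv_X_of_ne (zero_ne_one' (Fin 2)).symm,
        mulPoly_zero_left, zero_add, mulPoly_X_one]
      rfl

theorem mulPoly_leibniz_snd (p : MvPolynomial (Fin 2) ℂ) (F : ℤ → ℤ → W) :
    derivSnd W (mulPoly p F)
      = mulPoly (MvPolynomial.pderiv 1 p) F + mulPoly p (derivSnd W F) := by
  refine leibniz_of_generators (mulPolyHom W) (derivSnd W) 1 (fun c F => ?_) (fun j F => ?_) p F
  · simp only [mulPolyHom_apply, mulPoly_C]
    funext m t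
    exact smul_comm _ _ _
  · simp only [mulPolyHom_apply]
    fin_cases j
    · simp only [Fin.zero_eta, MvPolynomial.pderiv_X_of_ne (zero_ne_one' (Fin 2)),
        mulPoly_zero_left, zero_add, mulPoly_X_zero]
      rfl
    · have h := mulPoly_C 1 F
      rw [MvPolynomial.C_1, one_smul] at h
      simp only [Fin.mk_one, MvPolynomial.pderiv_X_self, h, mulPoly_X_one]
      funext m t
      simp only [derivSnd_apply, Pi.add_apply, sub_add_cancel, add_sub_cancel_right]
      push_cast
      module

theorem cf_qK_one_smul (α : ℂ) (y : LM2 W) (J T : ℤ) : cf (qK 1 α • y) J T = cf y J T := by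
  rw [← MvPolynomial.C_1, cf_qK_C_smul, one_smul]

theorem cf_qK_zero_smul (α : ℂ) (y : LM2 W) (J T : ℤ) : cf (qK 0 α • y) J T = 0 := by
  rw [← MvPolynomial.C_0, cf_qK_C_smul, zero_smul]

theorem qK_leibniz_outer (α : ℂ) (p : MvPolynomial (Fin 2) ℂ) (y : LM2 W) :
    outerDeriv W (qK p α • y)
      = qK (MvPolynomial.pderiv 0 p) α • y + qK p α • outerDeriv W y := by
  refine leibniz_of_generators (qKHom W α) (outerDeriv W) 0 (fun c y => ?_) (fun j y => ?_) p y
  · apply cf_ext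
    intro J T
    simp only [qKHom_apply, cf_outerDeriv, cf_qK_C_smul]
    exact smul_comm _ _ _
  · apply cf_ext
    intro J T
    simp only [qKHom_apply]
    fin_cases j
    · simp only [Fin.zero_eta, MvPolynomial.pderiv_X_self, cf_add, cf_outerDeriv,
        cf_qK_X_zero_smul, cf_qK_one_smul, sub_add_cancel, add_sub_cancel_right]
      push_cast
      module
    · simp only [Fin.mk_one, MvPolynomial.pderiv_X_of_ne (zero_ne_one' (Fin 2)).symm, cf_add,
        cf_outerDeriv, cf_qK_X_one_smul, cf_qK_zero_smul, zero_add]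

theorem qK_leibniz_mixed (α : ℂ) (p : MvPolynomial (Fin 2) ℂ) (y : LM2 W) :
    mixedDeriv W α (qK p α • y)
      = qK (MvPolynomial.pderiv 1 p) α • y + qK p α • mixedDeriv W α y := by
  refine leibniz_of_generators (qKHom W α) (mixedDeriv W α) 1 (fun c y => ?_) (fun j y => ?_) p y
  · apply cf_ext
    intro J T
    simp only [qKHom_apply, cf_mixedDeriv, cf_qK_C_smul]
    module
  · apply cf_ext
    intro J T
    simp only [qKHom_apply]
    fin_cases j
    · simp only [Fin.zero_eta, MvPolynomial.pderiv_X_of_ne (zero_ne_one' (Fin 2)), cf_add,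
        cf_mixedDeriv, cf_qK_X_zero_smul, cf_qK_zero_smul, sub_add_cancel, add_sub_cancel_right]
      push_cast
      module
    · simp only [Fin.mk_one, MvPolynomial.pderiv_X_self, cf_add,
        cf_mixedDeriv, cf_qK_X_one_smul, cf_qK_one_smul, sub_add_cancel, add_sub_cancel_right]
      push_cast
      module

theorem subst_derivFst (α : ℂ) {F : ℤ → ℤ → W} (hF : IsLaurent2 F) :
    subst α (derivFst W F) = outerDeriv W (subst α F) := by
  apply cf_ext
  intro J T
  rw [cf_subst α (isLaurent2_derivFst hF), cf_outerDeriv, cf_subst α hF, substCoeff, substCoeff,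
    smul_finsum, finsum_shift fun m => ((J : ℂ) + 1) • substTerm α F (J + 1) T m]
  refine finsum_congr fun m => ?_
  have h1 : T - (m + 1) + (J + 1) = T - m + J := by ring
  simp only [substTerm, derivFst_apply, h1, smul_smul, add_sub_add_right_eq_sub]
  congr 1
  rw [← mul_assoc, succ_mul_binomZ_succ_succ]
  ring

theorem subst_derivSnd {α : ℂ} (hα : α ≠ 0) {F : ℤ → ℤ → W} (hF : IsLaurent2 F) :
    subst α (derivSnd W F) = mixedDeriv W α (subst α F) := by
  apply cf_ext
  intro J T
  rw [cf_subst α (isLaurent2_derivSnd hF), cf_mixedDeriv, cf_subst α hF, cf_subst α hF,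
    substCoeff, substCoeff, substCoeff, smul_finsum, smul_finsum, smul_finsum,
    ← finsum_sub_distrib
      (support_smul_finite _ (substTerm_support_finite α hF _ _))
      (support_smul_finite _ (support_smul_finite _ (substTerm_support_finite α hF _ _)))]
  refine finsum_congr fun m => ?_
  have h1 : T + 1 - m + J = T - m + J + 1 := by ring
  have h2 : T - m + (J + 1) = T - m + J + 1 := by ring
  have h3 : m - J = m - (J + 1) + 1 := by ring
  simp only [substTerm, derivSnd_apply, h1, h2, smul_smul, ← sub_smul]
  congr 1
  rw [h3, zpow_add_one₀ hα]
  push_cast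
  linear_combination (α ^ (m - (J + 1)) * α) * succ_mul_binomZ_succ m J

end Derivatives

section Rescaling

/-- `F(x₁, x₂) ↦ F(γx₁, δx₂)`. -/
def rescale (W : Type*) [AddCommGroup W] [Module ℂ W] (γ δ : ℂ) :
    (ℤ → ℤ → W) →+ (ℤ → ℤ → W) where
  toFun F m t := (γ ^ m * δ ^ t) • F m t
  map_zero' := by funext m t; exact smul_zero _
  map_add' F G := by funext m t; exact smul_add _ _ _

theorem rescale_apply (γ δ : ℂ) (F : ℤ → ℤ → W) (m t : ℤ) :
    rescale W γ δ F m t = (γ ^ m * δ ^ t) • F m t := rfl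

theorem isLaurent2_rescale (γ δ : ℂ) {F : ℤ → ℤ → W} (hF : IsLaurent2 F) :
    IsLaurent2 (rescale W γ δ F) := by
  obtain ⟨N, hN⟩ := hF
  exact ⟨N, fun m t h => by rw [rescale_apply, hN m t h, smul_zero]⟩

theorem isIterated_rescale (γ δ : ℂ) {f : ℤ → ℤ → W} (hf : IsIterated f) :
    IsIterated (rescale W γ δ f) := by
  obtain ⟨⟨N, hN⟩, h⟩ := hf
  refine ⟨⟨N, fun J hJ T => by rw [rescale_apply, hN J hJ, smul_zero]⟩, fun J => ?_⟩
  obtain ⟨M, hM⟩ := h J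
  exact ⟨M, fun T hT => by rw [rescale_apply, hM T hT, smul_zero]⟩

/-- `y(x₀, x) ↦ y(γx₀, δx)` on `W((x))((x₀))`. -/
def rescaleCf (W : Type*) [AddCommGroup W] [Module ℂ W] (γ δ : ℂ) : LM2 W →+ LM2 W :=
  liftCf (rescale W γ δ) fun _ => isIterated_rescale γ δ

theorem cf_rescaleCf (γ δ : ℂ) (y : LM2 W) (J T : ℤ) :
    cf (rescaleCf W γ δ y) J T = (γ ^ J * δ ^ T) • cf y J T :=
  cf_liftCf _ _ y J T

/-- `p(x₁, x₂) ↦ p(γx₁, δx₂)`. -/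
def rescalePoly (γ δ : ℂ) : MvPolynomial (Fin 2) ℂ →ₐ[ℂ] MvPolynomial (Fin 2) ℂ :=
  MvPolynomial.aeval ![MvPolynomial.C γ * MvPolynomial.X 0, MvPolynomial.C δ * MvPolynomial.X 1]

theorem rescalePoly_C (γ δ c : ℂ) :
    rescalePoly γ δ (MvPolynomial.C c) = MvPolynomial.C c :=
  MvPolynomial.aeval_C _ _

theorem rescalePoly_X_zero (γ δ : ℂ) :
    rescalePoly γ δ (MvPolynomial.X 0) = MvPolynomial.C γ * MvPolynomial.X 0 :=
  MvPolynomial.aeval_X _ _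

theorem rescalePoly_X_one (γ δ : ℂ) :
    rescalePoly γ δ (MvPolynomial.X 1) = MvPolynomial.C δ * MvPolynomial.X 1 :=
  MvPolynomial.aeval_X _ _

theorem rescalePoly_ne_zero {γ δ : ℂ} (hγ : γ ≠ 0) (hδ : δ ≠ 0) {p : MvPolynomial (Fin 2) ℂ}
    (hp : p ≠ 0) : rescalePoly γ δ p ≠ 0 := by
  have h : (rescalePoly γ⁻¹ δ⁻¹).comp (rescalePoly γ δ) = AlgHom.id ℂ _ := by
    ext k : 1
    fin_cases k
    · simp only [AlgHom.comp_apply, Fin.zero_eta, rescalePoly_X_zero, map_mul, rescalePoly_C,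
        ← mul_assoc, ← MvPolynomial.C_mul, mul_inv_cancel₀ hγ, MvPolynomial.C_1, one_mul,
        AlgHom.id_apply]
    · simp only [AlgHom.comp_apply, Fin.mk_one, rescalePoly_X_one, map_mul, rescalePoly_C,
        ← mul_assoc, ← MvPolynomial.C_mul, mul_inv_cancel₀ hδ, MvPolynomial.C_1, one_mul,
        AlgHom.id_apply]
  intro h0
  apply hp
  rw [← AlgHom.id_apply (R := ℂ) p, ← h, AlgHom.comp_apply, h0, map_zero]

theorem rescale_mulPoly {γ δ : ℂ} (hγ : γ ≠ 0) (hδ : δ ≠ 0) (p : MvPolynomial (Fin 2) ℂ)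
    (F : ℤ → ℤ → W) :
    rescale W γ δ (mulPoly p F) = mulPoly (rescalePoly γ δ p) (rescale W γ δ F) := by
  refine intertwine_of_generators (mulPolyHom W)
    ((mulPolyHom W).comp (rescalePoly γ δ).toRingHom) ⊤ (fun _ _ _ => trivial) (rescale W γ δ)
    (fun y _ z _ => map_add _ y z) (fun c y _ => ?_) (fun i y _ => ?_) p F trivial
  · change rescale W γ δ (mulPoly _ y) = mulPoly (rescalePoly γ δ _) _
    rw [rescalePoly_C, mulPoly_C, mulPoly_C]
    funext m t
    exact smul_comm _ _ _
  · change rescale W γ δ (mulPoly _ y) = mulPoly (rescalePoly γ δ _) _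
    fin_cases i
    · simp only [Fin.zero_eta, rescalePoly_X_zero, mulPoly_mul, mulPoly_C, mulPoly_X_zero]
      funext m t
      simp only [Pi.smul_apply, rescale_apply, smul_smul]
      rw [zpow_sub_one₀ hγ]
      congr 1
      field_simp
    · simp only [Fin.mk_one, rescalePoly_X_one, mulPoly_mul, mulPoly_C, mulPoly_X_one]
      funext m t
      simp only [Pi.smul_apply, rescale_apply, smul_smul]
      rw [zpow_sub_one₀ hδ]
      congr 1
      field_simp

theorem K2_smul_add (q : K2) (y z : LM2 W) : q • (y + z) = q • y + q • z :=
  map_add (Module.toAddMonoidEnd K2 (LM2 W) q) y z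

theorem K2_mul_smul (q r : K2) (y : LM2 W) : (q * r) • y = q • r • y :=
  DFunLike.congr_fun (map_mul (Module.toAddMonoidEnd K2 (LM2 W)) q r) y

theorem qK_mul_smul (p q : MvPolynomial (Fin 2) ℂ) (α : ℂ) (y : LM2 W) :
    qK (p * q) α • y = qK p α • qK q α • y := by
  rw [qK_mul, K2_mul_smul]

theorem rescaleCf_qK {γ δ : ℂ} (hγ : γ ≠ 0) (hδ : δ ≠ 0) (α : ℂ) (p : MvPolynomial (Fin 2) ℂ)
    (y : LM2 W) :
    rescaleCf W γ δ (qK p (α * γ / δ) • y)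
      = qK (rescalePoly γ δ p) α • rescaleCf W γ δ y := by
  refine intertwine_of_generators (qKHom W (α * γ / δ))
    ((qKHom W α).comp (rescalePoly γ δ).toRingHom) ⊤ (fun _ _ _ => trivial) (rescaleCf W γ δ)
    (fun y _ z _ => map_add _ y z) (fun c y _ => ?_) (fun i y _ => ?_) p y trivial
  · change rescaleCf W γ δ (qK _ _ • y) = qK (rescalePoly γ δ _) _ • _
    apply cf_ext
    intro J T
    rw [rescalePoly_C, cf_rescaleCf, cf_qK_C_smul, cf_qK_C_smul, cf_rescaleCf]
    exact smul_comm _ _ _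
  · change rescaleCf W γ δ (qK _ _ • y) = qK (rescalePoly γ δ _) _ • _
    apply cf_ext
    intro J T
    fin_cases i
    · simp only [Fin.zero_eta, rescalePoly_X_zero, qK_mul_smul, cf_rescaleCf, cf_qK_C_smul,
        cf_qK_X_zero_smul, smul_add, smul_smul]
      rw [zpow_sub_one₀ hγ, zpow_sub_one₀ hδ]
      congr 2 <;> field_simp
    · simp only [Fin.mk_one, rescalePoly_X_one, qK_mul_smul, cf_rescaleCf, cf_qK_C_smul,
        cf_qK_X_one_smul, smul_smul]
      rw [zpow_sub_one₀ hδ]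
      congr 1
      field_simp

theorem subst_rescale {γ δ : ℂ} (hγ : γ ≠ 0) (hδ : δ ≠ 0) (α : ℂ) {F : ℤ → ℤ → W}
    (hF : IsLaurent2 F) :
    subst α (rescale W γ δ F) = rescaleCf W γ δ (subst (α * γ / δ) F) := by
  apply cf_ext
  intro J T
  rw [cf_subst α (isLaurent2_rescale γ δ hF), cf_rescaleCf, cf_subst _ hF, substCoeff,
    substCoeff, smul_finsum]
  refine finsum_congr fun m => ?_
  simp only [substTerm, rescale_apply, smul_smul]
  congr 1
  have h : T - m + J = T - (m - J) := by ring
  rw [h, div_zpow, mul_zpow, zpow_sub₀ hδ, zpow_sub₀ hγ]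
  have := zpow_ne_zero J hγ
  field_simp

end Rescaling

section Quotient

/-- `y = ι(p(x₀ + αx, x)⁻¹) (p F)(αx + x₀, x)`, where `p F ∈ W((x₁, x₂))`. -/
def IsQuotient (α : ℂ) (p : MvPolynomial (Fin 2) ℂ) (F : ℤ → ℤ → W) (y : LM2 W) : Prop :=
  IsLaurent2 (mulPoly p F) ∧ qK p α • y = subst α (mulPoly p F)

variable {α : ℂ} {p q : MvPolynomial (Fin 2) ℂ} {F : ℤ → ℤ → W} {y z : LM2 W}

theorem IsQuotient.mul (hα : α ≠ 0) (h : IsQuotient α p F y) (q : MvPolynomial (Fin 2) ℂ) :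
    IsQuotient α (q * p) F y := by
  rw [IsQuotient, mulPoly_mul]
  exact ⟨isLaurent2_mulPoly q h.1, by rw [subst_mulPoly hα h.1, qK_mul_smul, h.2]⟩

theorem qK_inv_smul_smul (hp : p ≠ 0) (α : ℂ) (y : LM2 W) : qInv p α • qK p α • y = y := by
  have h : qInv p α * qK p α = 1 :=
    @inv_mul_cancel₀ K2 _ _ (qK_ne_zero hp α)
  rw [← K2_mul_smul, h]
  exact one_smul K2 y

theorem qK_smul_inv_smul (hp : p ≠ 0) (α : ℂ) (y : LM2 W) : qK p α • qInv p α • y = y := by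
  have h : qK p α * qInv p α = 1 :=
    @mul_inv_cancel₀ K2 _ _ (qK_ne_zero hp α)
  rw [← K2_mul_smul, h]
  exact one_smul K2 y

theorem IsQuotient.eq_qInv_smul (hp : p ≠ 0) (h : IsQuotient α p F y) :
    y = qInv p α • subst α (mulPoly p F) := by
  rw [← h.2, qK_inv_smul_smul hp]

theorem isQuotient_qInv_smul (α : ℂ) (hp : p ≠ 0) (h : IsLaurent2 (mulPoly p F)) :
    IsQuotient α p F (qInv p α • subst α (mulPoly p F)) :=
  ⟨h, qK_smul_inv_smul hp α _⟩

theorem IsQuotient.unique (hα : α ≠ 0) (hp : p ≠ 0) (hq : q ≠ 0) (hy : IsQuotient α p F y)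
    (hz : IsQuotient α q F z) : y = z := by
  have h1 := hz.mul hα p
  have h2 := hy.mul hα q
  rw [mul_comm] at h2
  rw [h1.eq_qInv_smul (mul_ne_zero hp hq), h2.eq_qInv_smul (mul_ne_zero hp hq)]

theorem IsQuotient.add {G : ℤ → ℤ → W} (hy : IsQuotient α p F y) (hz : IsQuotient α p G z) :
    IsQuotient α p (F + G) (y + z) := by
  rw [IsQuotient, mulPoly_add_right]
  exact ⟨(laurent2 W).add_mem hy.1 hz.1,
    by rw [K2_smul_add, subst_add α hy.1 hz.1, hy.2, hz.2]⟩

theorem IsQuotient.smul (hα : α ≠ 0) (hy : IsQuotient α p F y) (c : ℂ) :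
    IsQuotient α p (c • F) (qK (MvPolynomial.C c) α • y) := by
  have h := hy.mul hα (MvPolynomial.C c)
  rw [IsQuotient, ← mulPoly_C, ← mulPoly_mul, mul_comm, ← qK_mul_smul, mul_comm p]
  exact h

/-- Quotients are compatible with derivations. -/
theorem IsQuotient.map_derivation (hα : α ≠ 0) (i : Fin 2)
    (d : (ℤ → ℤ → W) →+ (ℤ → ℤ → W)) (hd : ∀ F, IsLaurent2 F → IsLaurent2 (d F))
    (hd' : ∀ p F, d (mulPoly p F) = mulPoly (MvPolynomial.pderiv i p) F + mulPoly p (d F))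
    (e : LM2 W →+ LM2 W)
    (he : ∀ p y, e (qK p α • y) = qK (MvPolynomial.pderiv i p) α • y + qK p α • e y)
    (hde : ∀ F, IsLaurent2 F → subst α (d F) = e (subst α F))
    (h : IsQuotient α p F y) : IsQuotient α (p * p) (d F) (e y) := by
  have h1 : mulPoly p (d (mulPoly p F))
      = mulPoly (MvPolynomial.pderiv i p) (mulPoly p F) + mulPoly (p * p) (d F) := by
    rw [hd', mulPoly_add_right, ← mulPoly_mul, ← mulPoly_mul, ← mulPoly_mul,
      mul_comm p (MvPolynomial.pderiv i p)]
  have h2 : IsLaurent2 (mulPoly (MvPolynomial.pderiv i p) (mulPoly p F)) :=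
    isLaurent2_mulPoly _ h.1
  have h3 : IsLaurent2 (mulPoly (p * p) (d F)) := by
    rw [← sub_eq_of_eq_add' h1]
    exact (laurent2 W).sub_mem (isLaurent2_mulPoly p (hd _ h.1)) h2
  have h4 := congrArg (subst α) h1
  rw [subst_add α h2 h3, subst_mulPoly hα (hd _ h.1), subst_mulPoly hα h.1, hde _ h.1, ← h.2,
    he] at h4
  have h5 : qK p α • (qK (MvPolynomial.pderiv i p) α • y + qK p α • e y)
      = qK (MvPolynomial.pderiv i p) α • qK p α • y + qK (p * p) α • e y := by
    rw [K2_smul_add, ← qK_mul_smul, ← qK_mul_smul, ← qK_mul_smul,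
      mul_comm p (MvPolynomial.pderiv i p)]
  exact ⟨h3, add_left_cancel (h5.symm.trans h4)⟩

theorem IsQuotient.derivFst (hα : α ≠ 0) (h : IsQuotient α p F y) :
    IsQuotient α (p * p) (derivFst W F) (outerDeriv W y) :=
  h.map_derivation hα 0 _ (fun _ => isLaurent2_derivFst) mulPoly_leibniz_fst _
    (qK_leibniz_outer α) (fun _ => subst_derivFst α)

theorem IsQuotient.derivSnd (hα : α ≠ 0) (h : IsQuotient α p F y) :
    IsQuotient α (p * p) (derivSnd W F) (mixedDeriv W α y) :=
  h.map_derivation hα 1 _ (fun _ => isLaurent2_derivSnd) mulPoly_leibniz_snd _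
    (qK_leibniz_mixed α) (fun _ => subst_derivSnd hα)

theorem IsQuotient.rescale {γ δ : ℂ} (hγ : γ ≠ 0) (hδ : δ ≠ 0)
    (h : IsQuotient (α * γ / δ) p F y) :
    IsQuotient α (rescalePoly γ δ p) (rescale W γ δ F) (rescaleCf W γ δ y) := by
  rw [IsQuotient, ← rescale_mulPoly hγ hδ]
  exact ⟨isLaurent2_rescale γ δ h.1,
    by rw [← rescaleCf_qK hγ hδ, h.2, subst_rescale hγ hδ α h.1]⟩

end Quotient

section VertexOperation

theorem mf_add (a : EW W) (w w' : W) (n : ℤ) : mf a (w + w') n = mf a w n + mf a w' n :=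
  congrFun (map_add (a : W →ₗ[ℂ] (ℤ → W)) w w') n

theorem mf_smul (a : EW W) (c : ℂ) (w : W) (n : ℤ) : mf a (c • w) n = c • mf a w n :=
  congrFun (map_smul (a : W →ₗ[ℂ] (ℤ → W)) c w) n

theorem EW_ext {a b : EW W} (h : ∀ w m, mf a w m = mf b w m) : a = b :=
  Subtype.ext (LinearMap.ext fun w => funext fun m => h w m)

theorem Fab_add (a b : EW W) (w w' : W) : Fab a b (w + w') = Fab a b w + Fab a b w' := by
  funext m t
  simp only [Fab, mf_add, Pi.add_apply]

theorem Fab_smul (a b : EW W) (c : ℂ) (w : W) : Fab a b (c • w) = c • Fab a b w := by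
  funext m t
  simp only [Fab, mf_smul, Pi.smul_apply]

theorem mf_Dop (a : EW W) (w : W) (m : ℤ) : mf (Dop a) w m = (-m : ℂ) • mf a w (m - 1) := rfl

theorem mf_RaE (α : ℂˣ) (a : EW W) (w : W) (m : ℤ) :
    mf (RaE α a) w m = ((α : ℂ) ^ (-m - 1 : ℤ)) • mf a w m := rfl

theorem Fab_Dop_left (a b : EW W) (w : W) : Fab (Dop a) b w = derivFst W (Fab a b w) := by
  funext m t
  have h : -m - 1 - 1 = -(m + 1) - 1 := by ring
  simp only [Fab, mf_Dop, derivFst_apply, h]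
  congr 1
  push_cast
  ring

theorem Fab_Dop_right (a b : EW W) (w : W) : Fab a (Dop b) w = derivSnd W (Fab a b w) := by
  funext m t
  have h : -t - 1 - 1 = -(t + 1) - 1 := by ring
  simp only [Fab, mf_Dop, derivSnd_apply, h, mf_smul]
  congr 1
  push_cast
  ring

theorem Fab_RaE (γ δ : ℂˣ) (a b : EW W) (w : W) :
    Fab (RaE γ a) (RaE δ b) w = rescale W γ δ (Fab a b w) := by
  funext m t
  have h (k : ℤ) : -(-k - 1) - 1 = k := by ring
  simp only [Fab, mf_RaE, rescale_apply, mf_smul, h, smul_smul, mul_comm]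

theorem RaE_one (a : EW W) : RaE 1 a = a :=
  EW_ext fun w m => by rw [mf_RaE, Units.val_one, one_zpow, one_smul]

theorem RaE_RaE_inv (α : ℂˣ) (a : EW W) : RaE α (RaE α⁻¹ a) = a :=
  EW_ext fun w m => by
    rw [mf_RaE, mf_RaE, smul_smul, ← mul_zpow, Units.mul_inv, one_zpow, one_smul]

theorem fullYE_eq (α : ℂ) {p : MvPolynomial (Fin 2) ℂ} (a b : EW W) (w : W)
    (h : IsLaurent2 (mulPoly p (Fab a b w))) (J T : ℤ) :
    fullYE α p a b w J T = cf (qInv p α • subst α (mulPoly p (Fab a b w))) J T := by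
  rw [cf_smul, fullYE]
  refine finsum_congr fun s => ?_
  congr 1
  rw [cf_subst α h, substCoeff]
  split_ifs with hs
  · refine finsum_congr fun m => ?_
    rw [substTerm, binomZ, if_pos hs, Int.toNat_of_nonneg hs]
  · exact (finsum_eq_zero_of_forall_eq_zero fun m => by
      rw [substTerm, binomZ, if_neg hs, zero_mul, zero_smul]).symm

theorem exists_mf_eq_rawYE {α : ℂ} (hα : α ≠ 0) {a b : EW W} (h : QCPair a b) (n : ℤ) :
    ∃ c : EW W, ∀ w m, mf c w m = rawYE α a b n w m := by
  have hp := h.choose_spec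
  have hy w := isQuotient_qInv_smul α hp.1 (hp.2 w)
  have hraw w m : rawYE α a b n w m = cf (qInv h.choose α •
      subst α (mulPoly h.choose (Fab a b w))) (-n - 1) (-m - 1) := by
    rw [rawYE, dif_pos h, fullYE_eq α a b w (hp.2 w)]
  refine ⟨⟨{ toFun := rawYE α a b n, map_add' := fun w w' => ?_, map_smul' := fun c w => ?_ },
    fun w => ?_⟩, fun w m => rfl⟩
  · funext m
    have := (hy w).add (hy w')
    rw [← Fab_add] at this
    rw [hraw, (hy (w + w')).unique hα hp.1 hp.1 this, cf_add, Pi.add_apply, hraw, hraw]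
  · funext m
    have := (hy w).smul hα c
    rw [← Fab_smul] at this
    rw [hraw, (hy (c • w)).unique hα hp.1 hp.1 this, cf_qK_C_smul, Pi.smul_apply, hraw,
      RingHom.id_apply]
  · obtain ⟨N, hN⟩ := cf_bounded_inner (qInv h.choose α •
      subst α (mulPoly h.choose (Fab a b w))) (-n - 1)
    exact ⟨-N, fun m hm => (hraw w m).trans (hN _ (by omega))⟩

/-- The modes of `Y_ℰ^{(α)}(a(x), x₀) b(x)` may be computed with any admissible polynomial. -/
theorem mf_YEa {α : ℂˣ} {a b : EW W} {p : MvPolynomial (Fin 2) ℂ} (hp : p ≠ 0)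
    (hab : ∀ w, IsLaurent2 (mulPoly p (Fab a b w))) {w : W} {y : LM2 W}
    (hy : IsQuotient (α : ℂ) p (Fab a b w) y) (n m : ℤ) :
    mf (YEa α a b n) w m = cf y (-n - 1) (-m - 1) := by
  have h : QCPair a b := ⟨p, hp, hab⟩
  have hc := exists_mf_eq_rawYE α.ne_zero h n
  have hq := h.choose_spec
  rw [YEa, dif_pos hc, hc.choose_spec, rawYE, dif_pos h, fullYE_eq _ a b w (hq.2 w),
    hy.unique α.ne_zero hp hq.1 (isQuotient_qInv_smul α hq.1 (hq.2 w))]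

end VertexOperation

theorem QCPair.exists_isQuotient {α : ℂ} {a b : EW W} (h : QCPair a b) :
    ∃ p : MvPolynomial (Fin 2) ℂ, p ≠ 0 ∧ (∀ w, IsLaurent2 (mulPoly p (Fab a b w))) ∧
      ∀ w, ∃ y, IsQuotient α p (Fab a b w) y := by
  obtain ⟨p, hp, hab⟩ := h
  exact ⟨p, hp, hab, fun w => ⟨_, isQuotient_qInv_smul α hp (hab w)⟩⟩

theorem QCPair.Dop_left {a b : EW W} (h : QCPair a b) : QCPair (Dop a) b := by
  obtain ⟨p, hp, -, hy⟩ := h.exists_isQuotient (α := 1)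
  refine ⟨p * p, mul_ne_zero hp hp, fun w => ?_⟩
  obtain ⟨y, hy⟩ := hy w
  rw [Fab_Dop_left]
  exact (hy.derivFst one_ne_zero).1

theorem QCPair.Dop_right {a b : EW W} (h : QCPair a b) : QCPair a (Dop b) := by
  obtain ⟨p, hp, -, hy⟩ := h.exists_isQuotient (α := 1)
  refine ⟨p * p, mul_ne_zero hp hp, fun w => ?_⟩
  obtain ⟨y, hy⟩ := hy w
  rw [Fab_Dop_right]
  exact (hy.derivSnd one_ne_zero).1

theorem QCPair.RaE {a b : EW W} (h : QCPair a b) (γ δ : ℂˣ) :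
    QCPair (RaE γ a) (RaE δ b) := by
  obtain ⟨p, hp, hab⟩ := h
  refine ⟨rescalePoly γ δ p, rescalePoly_ne_zero γ.ne_zero δ.ne_zero hp, fun w => ?_⟩
  rw [Fab_RaE, ← rescale_mulPoly γ.ne_zero δ.ne_zero]
  exact isLaurent2_rescale _ _ (hab w)

theorem YEa_Dop_left {a b : EW W} (h : QCPair a b) (α : ℂˣ) (n : ℤ) :
    YEa α (Dop a) b n = (-n : ℂ) • YEa α a b (n - 1) := by
  obtain ⟨p, hp, hab, hy⟩ := h.exists_isQuotient (α := α)
  refine EW_ext fun w m => ?_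
  obtain ⟨y, hyw⟩ := hy w
  have hD w : ∃ z, IsQuotient (α : ℂ) (p * p) (Fab (Dop a) b w) z := by
    obtain ⟨z, hz⟩ := hy w
    exact ⟨_, Fab_Dop_left a b w ▸ hz.derivFst α.ne_zero⟩
  have hyD := hyw.derivFst α.ne_zero
  rw [← Fab_Dop_left] at hyD
  refine (mf_YEa (mul_ne_zero hp hp) (fun w => (hD w).choose_spec.1) hyD n m).trans ?_
  change _ = (-n : ℂ) • mf (YEa α a b (n - 1)) w m
  have h1 : -(n - 1) - 1 = -n - 1 + 1 := by ring
  rw [mf_YEa hp hab hyw, cf_outerDeriv, h1]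
  congr 1
  push_cast
  ring

theorem Dop_YEa_sub {a b : EW W} (h : QCPair a b) (α : ℂˣ) (n : ℤ) :
    Dop (YEa α a b n) - YEa α a (Dop b) n = ((α : ℂ) * (-n : ℂ)) • YEa α a b (n - 1) := by
  obtain ⟨p, hp, hab, hy⟩ := h.exists_isQuotient (α := α)
  refine EW_ext fun w m => ?_
  obtain ⟨y, hyw⟩ := hy w
  have hD w : ∃ z, IsQuotient (α : ℂ) (p * p) (Fab a (Dop b) w) z := by
    obtain ⟨z, hz⟩ := hy w
    exact ⟨_, Fab_Dop_right a b w ▸ hz.derivSnd α.ne_zero⟩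
  have hyD := hyw.derivSnd α.ne_zero
  rw [← Fab_Dop_right] at hyD
  change mf (Dop (YEa α a b n)) w m - mf (YEa α a (Dop b) n) w m
    = ((α : ℂ) * (-n : ℂ)) • mf (YEa α a b (n - 1)) w m
  have h1 : -(n - 1) - 1 = -n - 1 + 1 := by ring
  have h2 : -(m - 1) - 1 = -m - 1 + 1 := by ring
  rw [mf_YEa (mul_ne_zero hp hp) (fun w => (hD w).choose_spec.1) hyD, mf_Dop,
    mf_YEa hp hab hyw, mf_YEa hp hab hyw, cf_mixedDeriv, h1, h2]
  push_cast
  module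

/-- Rescaling of both arguments of the vertex operation. -/
theorem mf_YEa_RaE {a b : EW W} (h : QCPair a b) (α β γ δ : ℂˣ) (hβ : α * γ = β * δ) (n : ℤ)
    (w : W) (m : ℤ) :
    mf (YEa α (RaE γ a) (RaE δ b) n) w m
      = ((γ : ℂ) ^ (-n - 1) * (δ : ℂ) ^ (-m - 1)) • mf (YEa β a b n) w m := by
  obtain ⟨p, hp, hab, hy⟩ := h.exists_isQuotient (α := β)
  have hβ' : (β : ℂ) = α * γ / δ := by
    rw [eq_div_iff δ.ne_zero]
    exact_mod_cast hβ.symm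
  have hR w {y} (hy : IsQuotient (β : ℂ) p (Fab a b w) y) :
      IsQuotient (α : ℂ) (rescalePoly γ δ p) (Fab (RaE γ a) (RaE δ b) w)
        (rescaleCf W γ δ y) := by
    rw [Fab_RaE]
    exact IsQuotient.rescale γ.ne_zero δ.ne_zero (hβ' ▸ hy)
  obtain ⟨y, hyw⟩ := hy w
  rw [mf_YEa (rescalePoly_ne_zero γ.ne_zero δ.ne_zero hp)
    (fun w => (hR w (hy w).choose_spec).1) (hR w hyw), mf_YEa hp hab hyw, cf_rescaleCf]

theorem RaE_YEa {a b : EW W} (h : QCPair a b) (α β : ℂˣ) (n : ℤ) :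
    RaE α (YEa β a b n) = YEa (α * β) a (RaE α b) n := by
  refine EW_ext fun w m => ?_
  have := mf_YEa_RaE h (α * β) β 1 α (by rw [mul_one, mul_comm]) n w m
  rw [RaE_one, Units.val_one, one_zpow, one_mul] at this
  rw [this, mf_RaE]

theorem zpow_smul_YEa_RaE {a b : EW W} (h : QCPair a b) (α β : ℂˣ) (n : ℤ) :
    ((β : ℂ) ^ (n + 1)) • YEa α (RaE β a) b n = YEa (α * β) a b n := by
  refine EW_ext fun w m => ?_
  have := mf_YEa_RaE h α (α * β) β 1 (by rw [mul_one]) n w m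
  rw [RaE_one, Units.val_one, one_zpow, mul_one] at this
  change ((β : ℂ) ^ (n + 1)) • mf (YEa α (RaE β a) b n) w m = _
  rw [this, smul_smul, ← zpow_add₀ β.ne_zero, show n + 1 + (-n - 1) = 0 by ring, zpow_zero,
    one_smul]

end QuasiCompatiblePairs

/-- cf. Proposition 2.10 / `pbasic-property2`.  Let `(a(x), b(x))`
be a quasi compatible pair in `ℰ(W)` and `α, β ∈ ℂˣ`.  Then the pairs
`(a′(x), b(x))`, `(a(x), b′(x))` and `(a(αx), b(βx))` are quasi compatible and,
writing identities coefficientwise in `x₀`: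
`Y_ℰ^{(α)}(Da(x),x₀)b(x) = ∂/∂x₀ Y_ℰ^{(α)}(a(x),x₀)b(x)`,
`D Y_ℰ^{(α)}(a,x₀)b − Y_ℰ^{(α)}(a,x₀)Db = α ∂/∂x₀ Y_ℰ^{(α)}(a,x₀)b`,
`R_α Y_ℰ^{(β)}(a,x₀)b = Y_ℰ^{(αβ)}(a,x₀) R_α b`,
`Y_ℰ^{(α)}(R_β a, β⁻¹x₀)b = Y_ℰ^{(αβ)}(a,x₀)b`, and in particular
`Y_ℰ^{(α)}(a,x₀)b = R_α Y_ℰ(a,x₀) R_{α⁻¹} b = Y_ℰ(R_α a, α⁻¹x₀) b`. -/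
theorem statement5 {W : Type*} [AddCommGroup W] [Module ℂ W]
    (a b : EW W) (h : QCPair a b) (α β : ℂˣ) :
    QCPair (Dop a) b ∧ QCPair a (Dop b) ∧ QCPair (RaE α a) (RaE β b) ∧
    (∀ n : ℤ, YEa α (Dop a) b n = (-n : ℂ) • YEa α a b (n - 1)) ∧
    (∀ n : ℤ, Dop (YEa α a b n) - YEa α a (Dop b) n
        = ((α : ℂ) * (-n : ℂ)) • YEa α a b (n - 1)) ∧
    (∀ n : ℤ, RaE α (YEa β a b n) = YEa (α * β) a (RaE α b) n) ∧
    (∀ n : ℤ, ((β : ℂ) ^ (n + 1)) • YEa α (RaE β a) b n = YEa (α * β) a b n) ∧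
    (∀ n : ℤ, YEa α a b n = RaE α (YE a (RaE α⁻¹ b) n)) ∧
    (∀ n : ℤ, YEa α a b n = ((α : ℂ) ^ (n + 1)) • YE (RaE α a) b n) := by
  refine ⟨h.Dop_left, h.Dop_right, h.RaE α β, YEa_Dop_left h α, Dop_YEa_sub h α, RaE_YEa h α β,
    zpow_smul_YEa_RaE h α β, fun n => ?_, fun n => ?_⟩
  · have h' := h.RaE 1 α⁻¹
    rw [RaE_one] at h'
    rw [YE, RaE_YEa h', RaE_RaE_inv, mul_one]
  · rw [YE, zpow_smul_YEa_RaE h, one_mul]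

end NVA
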